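/- arXiv:2407.10731 — 2 statements merged into one kernel-verified Lean document; each statement's English description precedes it below -/
import Mathlib

section
/- Let J and K be n×n complex matrices such that JK = KJ, J†J = c·I for some real number c > 0, and K is nilpotent. If the matrix J + K is unitary, then K = 0 and c = 1. -/
open Matrix

/-- If `JK = KJ`, `JᴴJ = c·I` with `c > 0` real, `K` is nilpotent,
and `J + K` is unitary, then `K = 0` and `c = 1`. -/
theorem stmt_9 (n : ℕ) (hn : 0 < n) (J K : Matrix (Fin n) (Fin n) ℂ)
    (hJK : J * K = K * J) (c : ℝ) (hc : 0 < c) (hJ : Jᴴ * J = (c : ℂ) • 1)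
    (hKnil : ∃ m : ℕ, 0 < m ∧ K ^ m = 0)
    (hU : (J + K)ᴴ * (J + K) = 1) :
    K = 0 ∧ c = 1 := by
  have hc0 : (c : ℂ) ≠ 0 := by exact_mod_cast hc.ne'
  have hJ' : J * Jᴴ = (c : ℂ) • 1 := by
    have h1 : ((c : ℂ)⁻¹ • Jᴴ) * J = 1 := by
      rw [Matrix.smul_mul, hJ, smul_smul, inv_mul_cancel₀ hc0, one_smul]
    have h2 := mul_eq_one_comm.mp h1
    rw [Matrix.mul_smul] at h2
    rw [← h2, smul_smul, mul_inv_cancel₀ hc0, one_smul]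
  have hU' : (J + K) * (J + K)ᴴ = 1 := mul_eq_one_comm.mp hU
  have h1 : Jᴴ * K = K * Jᴴ := by
    have h : (c : ℂ) • (Jᴴ * K) = (c : ℂ) • (K * Jᴴ) := by
      calc (c : ℂ) • (Jᴴ * K) = Jᴴ * K * (J * Jᴴ) := by
            rw [hJ', Matrix.mul_smul, mul_one]
        _ = Jᴴ * (K * J) * Jᴴ := by simp only [mul_assoc]
        _ = (Jᴴ * J) * (K * Jᴴ) := by rw [← hJK]; simp only [mul_assoc]
        _ = (c : ℂ) • (K * Jᴴ) := by rw [hJ, Matrix.smul_mul, one_mul]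
    exact smul_right_injective _ hc0 h
  have h2 : Kᴴ * J = J * Kᴴ := by
    have := congrArg conjTranspose h1
    simpa [conjTranspose_mul] using this
  have hN : Kᴴ * K = K * Kᴴ := by
    have h := hU.trans hU'.symm
    rw [conjTranspose_add, add_mul, mul_add, mul_add, add_mul, mul_add, mul_add,
      hJ, hJ', h1, h2] at h
    have h3 := sub_eq_zero.mpr h
    rw [← sub_eq_zero, ← h3]
    abel
  have key : ∀ B : Matrix (Fin n) (Fin n) ℂ, K * (K * B) = 0 → K * B = 0 := by
    intro B hB
    open ComplexOrder in
    rw [← conjTranspose_mul_self_mul_eq_zero, mul_assoc, ← self_mul_conjTranspose_mul_eq_zero,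
      ← hN, mul_assoc, hB, mul_zero]
  have hK : K = 0 := by
    obtain ⟨m, hm, hKm⟩ := hKnil
    have : ∀ k : ℕ, K ^ (k + 1) = 0 → K = 0 := by
      intro k
      induction k with
      | zero => intro h; simpa using h
      | succ k ih =>
        intro h
        apply ih
        rw [pow_succ'] at h ⊢
        rw [pow_succ'] at h
        exact key _ h
    exact this (m - 1) (by rwa [Nat.sub_add_cancel hm])
  refine ⟨hK, ?_⟩
  rw [hK, add_zero, hJ] at hU
  have := congrFun (congrFun hU ⟨0, hn⟩) ⟨0, hn⟩
  simp at this
  exact this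
end

section
/- Let A, B, C be N×N complex matrices that pairwise anticommute (AB = −BA, CA = −AC, CB = −BC), and let α, β be complex numbers. Then the operator R = α·A⊗B⊗C + β·B⊗A⊗C on (ℂ^N)^{⊗3} satisfies the anti-tetrahedron equation R₁₂₃ R₁₄₅ R₂₄₆ R₃₅₆ = − R₃₅₆ R₂₄₆ R₁₄₅ R₁₂₃ as operators on (ℂ^N)^{⊗6}. -/
open Matrix Kronecker

/-- The operator on `(ℂ^N)^{⊗6}` acting as `R` on the tensor factors `i, j, k`
and as the identity on the remaining factors. -/
noncomputable def emb3 {N : ℕ} (i j k : Fin 6)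
    (R : Matrix (Fin N × Fin N × Fin N) (Fin N × Fin N × Fin N) ℂ) :
    Matrix (Fin 6 → Fin N) (Fin 6 → Fin N) ℂ :=
  Matrix.of fun a b =>
    R (a i, a j, a k) (b i, b j, b k) *
      ∏ l : Fin 6, if l = i ∨ l = j ∨ l = k then 1 else (if a l = b l then 1 else 0)

/-- Pure tensor operator on six factors. -/
noncomputable def pureT {N : ℕ} (M0 M1 M2 M3 M4 M5 : Matrix (Fin N) (Fin N) ℂ) :
    Matrix (Fin 6 → Fin N) (Fin 6 → Fin N) ℂ :=
  Matrix.of fun a b => M0 (a 0) (b 0) * M1 (a 1) (b 1) * M2 (a 2) (b 2) * M3 (a 3) (b 3) *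
    M4 (a 4) (b 4) * M5 (a 5) (b 5)

theorem pureF_mul {N : ℕ} (M P : Fin 6 → Matrix (Fin N) (Fin N) ℂ) (a b : Fin 6 → Fin N) :
    ∏ l, (M l * P l) (a l) (b l) =
      ∑ c : Fin 6 → Fin N, (∏ l, M l (a l) (c l)) * ∏ l, P l (c l) (b l) := by
  simp only [Matrix.mul_apply]
  rw [Finset.prod_univ_sum, Fintype.piFinset_univ]
  simp only [Finset.prod_mul_distrib]

theorem pureT_mul {N : ℕ} (M0 M1 M2 M3 M4 M5 P0 P1 P2 P3 P4 P5 : Matrix (Fin N) (Fin N) ℂ) :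
    pureT M0 M1 M2 M3 M4 M5 * pureT P0 P1 P2 P3 P4 P5 =
      pureT (M0 * P0) (M1 * P1) (M2 * P2) (M3 * P3) (M4 * P4) (M5 * P5) := by
  ext a b
  have h := pureF_mul ![M0, M1, M2, M3, M4, M5] ![P0, P1, P2, P3, P4, P5] a b
  simp only [Fin.prod_univ_six] at h
  rw [Matrix.mul_apply]
  exact h.symm

section
variable {N : ℕ} (M0 M1 M2 M3 M4 M5 : Matrix (Fin N) (Fin N) ℂ)

theorem pureT_neg0 : pureT (-M0) M1 M2 M3 M4 M5 = -pureT M0 M1 M2 M3 M4 M5 := by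
  ext a b; simp [pureT]
theorem pureT_neg1 : pureT M0 (-M1) M2 M3 M4 M5 = -pureT M0 M1 M2 M3 M4 M5 := by
  ext a b; simp [pureT]
theorem pureT_neg2 : pureT M0 M1 (-M2) M3 M4 M5 = -pureT M0 M1 M2 M3 M4 M5 := by
  ext a b; simp [pureT]
theorem pureT_neg3 : pureT M0 M1 M2 (-M3) M4 M5 = -pureT M0 M1 M2 M3 M4 M5 := by
  ext a b; simp [pureT]
theorem pureT_neg4 : pureT M0 M1 M2 M3 (-M4) M5 = -pureT M0 M1 M2 M3 M4 M5 := by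
  ext a b; simp [pureT]
end

theorem emb3_lin {N : ℕ} (i j k : Fin 6) (α β : ℂ)
    (R S : Matrix (Fin N × Fin N × Fin N) (Fin N × Fin N × Fin N) ℂ) :
    emb3 i j k (α • R + β • S) = α • emb3 i j k R + β • emb3 i j k S := by
  ext a b
  simp only [emb3, Matrix.of_apply, Matrix.add_apply, Matrix.smul_apply, smul_eq_mul]
  ring

section
variable {N : ℕ} (X Y Z : Matrix (Fin N) (Fin N) ℂ)

theorem emb3_012 : emb3 0 1 2 (X ⊗ₖ (Y ⊗ₖ Z)) = pureT X Y Z 1 1 1 := by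
  ext a b
  simp [emb3, pureT, Fin.prod_univ_six, Matrix.one_apply, Matrix.kroneckerMap_apply, mul_assoc]
theorem emb3_034 : emb3 0 3 4 (X ⊗ₖ (Y ⊗ₖ Z)) = pureT X 1 1 Y Z 1 := by
  ext a b
  simp [emb3, pureT, Fin.prod_univ_six, Matrix.one_apply, Matrix.kroneckerMap_apply, -mul_ite, -ite_mul]
  ring
theorem emb3_135 : emb3 1 3 5 (X ⊗ₖ (Y ⊗ₖ Z)) = pureT 1 X 1 Y 1 Z := by
  ext a b
  simp [emb3, pureT, Fin.prod_univ_six, Matrix.one_apply, Matrix.kroneckerMap_apply, -mul_ite, -ite_mul]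
  ring
theorem emb3_245 : emb3 2 4 5 (X ⊗ₖ (Y ⊗ₖ Z)) = pureT 1 1 X 1 Y Z := by
  ext a b
  simp [emb3, pureT, Fin.prod_univ_six, Matrix.one_apply, Matrix.kroneckerMap_apply, -mul_ite, -ite_mul]
  ring
end

/-- For pairwise anticommuting `A`, `B`, `C` and `α, β ∈ ℂ`, the
operator `R = α A⊗B⊗C + β B⊗A⊗C` satisfies the anti-tetrahedron equation
`R₁₂₃ R₁₄₅ R₂₄₆ R₃₅₆ = − R₃₅₆ R₂₄₆ R₁₄₅ R₁₂₃`. -/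
theorem stmt_19 {N : ℕ} (A B C : Matrix (Fin N) (Fin N) ℂ)
    (hAB : A * B = -(B * A)) (hCA : C * A = -(A * C)) (hCB : C * B = -(B * C))
    (α β : ℂ)
    (R : Matrix (Fin N × Fin N × Fin N) (Fin N × Fin N × Fin N) ℂ)
    (hR : R = α • (A ⊗ₖ (B ⊗ₖ C)) + β • (B ⊗ₖ (A ⊗ₖ C))) :
    emb3 0 1 2 R * emb3 0 3 4 R * emb3 1 3 5 R * emb3 2 4 5 R =
      -(emb3 2 4 5 R * emb3 1 3 5 R * emb3 0 3 4 R * emb3 0 1 2 R) := by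
  subst hR
  simp only [emb3_lin, emb3_012, emb3_034, emb3_135, emb3_245, add_mul, mul_add, smul_mul_assoc,
    mul_smul_comm, pureT_mul, mul_one, one_mul, hAB, hCA, hCB, pureT_neg0, pureT_neg1, pureT_neg2,
    pureT_neg3, pureT_neg4, neg_neg, smul_neg, neg_mul, mul_neg]
  module
end
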